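/- Let N and n be positive integers with n < N, let C, V_C, G, B11 be as in the standing assumptions, and let u : ℝ → ℝ^N. Suppose x : ℝ → ℝ^N is differentiable and satisfies C x′(t) + G x(t) = u(t) for all t ∈ ℝ. Then the projected coordinate x1(t) := V_C^T x(t) is differentiable and satisfies the decoupled differential equation B11 x1′(t) + x1(t) = V_C^T G^{-1} u(t) for all t ∈ ℝ. -/

import Mathlib

open Matrix

/-- If the columns of `V` are orthonormal and span the range of a symmetric matrix `C`, then the
orthogonal projection `V * Vᵀ` acts trivially on the right of `C`. -/
lemma mul_mul_transpose_eq_of_range_eq {ι κ : Type*} [Fintype ι] [Fintype κ] [DecidableEq ι]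
    [DecidableEq κ] {C : Matrix ι ι ℝ} {V : Matrix ι κ ℝ} (hC : Cᵀ = C) (hV : Vᵀ * V = 1)
    (hrange : LinearMap.range V.mulVecLin = LinearMap.range C.mulVecLin) :
    C * (V * Vᵀ) = C := by
  have h : V * Vᵀ * C = C := by
    refine Matrix.ext_of_mulVec_single fun i => ?_
    have hmem : C.mulVecLin (Pi.single i 1) ∈ LinearMap.range V.mulVecLin :=
      hrange ▸ LinearMap.mem_range_self _ _
    obtain ⟨w, hw⟩ := hmem
    simp only [mulVecLin_apply] at hw
    rw [← mulVec_mulVec, ← hw, mulVec_mulVec, Matrix.mul_assoc, hV, Matrix.mul_one]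
  simpa [transpose_mul, hC] using congrArg transpose h

/-- A real matrix with positive definite quadratic form has invertible determinant, even if it is
not symmetric. -/
lemma isUnit_det_of_coercive {ι : Type*} [Fintype ι] [DecidableEq ι] {G : Matrix ι ι ℝ} {ε : ℝ}
    (hε : 0 < ε) (hG : ∀ v : ι → ℝ, ε * (v ⬝ᵥ v) ≤ v ⬝ᵥ G.mulVec v) : IsUnit G.det := by
  rw [isUnit_iff_ne_zero]
  intro hdet
  obtain ⟨v, hv, hGv⟩ := exists_mulVec_eq_zero_iff.mpr hdet
  have h := hG v
  rw [hGv, dotProduct_zero] at h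
  have hpos : 0 ≤ v ⬝ᵥ v := Finset.sum_nonneg fun i _ => mul_self_nonneg (v i)
  exact hv (dotProduct_self_eq_zero.mp (le_antisymm (by nlinarith) hpos))

/-- Multiplication by a constant matrix commutes with differentiation. -/
lemma HasDerivAt.matrix_mulVec {ι κ : Type*} [Fintype ι] [Fintype κ] (A : Matrix κ ι ℝ)
    {x : ℝ → ι → ℝ} {x' : ι → ℝ} {t : ℝ} (hx : HasDerivAt x x' t) :
    HasDerivAt (fun t => A.mulVec (x t)) (A.mulVec x') t :=
  (LinearMap.toContinuousLinearMap A.mulVecLin).hasFDerivAt.comp_hasDerivAt t hx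

/-- if `x` is differentiable and satisfies `C x′(t) + G x(t) = u(t)` for all `t`,
then `x₁ := V_Cᵀ x` is differentiable and satisfies `B₁₁ x₁′(t) + x₁(t) = V_Cᵀ G⁻¹ u(t)`. -/
theorem stmt_3 (N n : ℕ) (hn : 0 < n) (hnN : n < N)
    (C G : Matrix (Fin N) (Fin N) ℝ)
    (VC : Matrix (Fin N) (Fin n) ℝ)
    (hC : C.PosSemidef) (hrank : C.rank = n)
    (hVC : VCᵀ * VC = 1)
    (hVCrange : LinearMap.range VC.mulVecLin = LinearMap.range C.mulVecLin)
    (ε : ℝ) (hε : 0 < ε)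
    (hG : ∀ v : Fin N → ℝ, ε * (v ⬝ᵥ v) ≤ v ⬝ᵥ G.mulVec v)
    (B11 : Matrix (Fin n) (Fin n) ℝ) (hB11 : B11 = VCᵀ * G⁻¹ * C * VC)
    (u : ℝ → Fin N → ℝ) (x : ℝ → Fin N → ℝ)
    (hx : Differentiable ℝ x)
    (hode : ∀ t : ℝ, C.mulVec (deriv x t) + G.mulVec (x t) = u t) :
    Differentiable ℝ (fun t => VCᵀ.mulVec (x t)) ∧
      ∀ t : ℝ,
        B11.mulVec (deriv (fun t => VCᵀ.mulVec (x t)) t) + VCᵀ.mulVec (x t) =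
          VCᵀ.mulVec (G⁻¹.mulVec (u t)) := by
  have hder (t : ℝ) := (hx t).hasDerivAt.matrix_mulVec VCᵀ
  refine ⟨fun t => (hder t).differentiableAt, fun t => ?_⟩
  have hCV : C * (VC * VCᵀ) = C :=
    mul_mul_transpose_eq_of_range_eq (by simpa using hC.isHermitian.eq) hVC hVCrange
  have hB : B11 * VCᵀ = VCᵀ * G⁻¹ * C := by
    rw [hB11, Matrix.mul_assoc, Matrix.mul_assoc, hCV]
  have hGx : G⁻¹.mulVec (G.mulVec (x t)) = x t := by
    rw [mulVec_mulVec, nonsing_inv_mul G (isUnit_det_of_coercive hε hG), one_mulVec]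
  rw [(hder t).deriv, mulVec_mulVec, hB, ← hode t, mulVec_add, mulVec_add, hGx,
    mulVec_mulVec, mulVec_mulVec, Matrix.mul_assoc]
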